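/- Let f : ℝ^{2n} → ℝ (n ≥ 1) be a smooth function with f(0) = 0, ∇f(0) = 0, and whose Hessian at the origin equals λ·Id for some λ > 0 (a non-degenerate minimum with all eigenvalues of d²f(0) equal). Then there is ε₀ > 0 such that for every ε ∈ (0, ε₀) the level set {f = ε} carries a periodic orbit of the Hamiltonian flow of f: there exists a nonconstant periodic curve γ : ℝ → ℝ^{2n} with γ'(t) = i∇f(γ(t)) for all t and f(γ(t)) = ε for all t. -/

import Mathlib

open scoped RealInnerProductSpace

lemma abs_mul_sub_mul_le {x x' y y' A B dx dy : ℝ} (hx : |x| ≤ A) (hy' : |y'| ≤ B)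
    (hdx : |x - x'| ≤ dx) (hdy : |y - y'| ≤ dy) : |x * y - x' * y'| ≤ A * dy + dx * B := by
  have e : x * y - x' * y' = x * (y - y') + (x - x') * y' := by ring
  rw [e]
  refine (abs_add_le _ _).trans ?_
  rw [abs_mul, abs_mul]
  have := (abs_nonneg x).trans hx
  have := (abs_nonneg _).trans hdx
  gcongr

lemma norm_smul_sub_smul_le {V : Type*} [NormedAddCommGroup V] [NormedSpace ℝ V]
    {x x' A B dx dy : ℝ} {y y' : V} (hx : |x| ≤ A) (hy' : ‖y'‖ ≤ B)
    (hdx : |x - x'| ≤ dx) (hdy : ‖y - y'‖ ≤ dy) : ‖x • y - x' • y'‖ ≤ A * dy + dx * B := by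
  have e : x • y - x' • y' = x • (y - y') + (x - x') • y' := by module
  rw [e]
  refine (norm_add_le _ _).trans ?_
  rw [norm_smul, norm_smul, Real.norm_eq_abs, Real.norm_eq_abs]
  have := (abs_nonneg x).trans hx
  have := (abs_nonneg _).trans hdx
  gcongr

lemma norm_triple_le_iff {V : Type*} [NormedAddCommGroup V] {z : V × ℝ × ℝ} {d : ℝ} :
    ‖z‖ ≤ d ↔ ‖z.1‖ ≤ d ∧ |z.2.1| ≤ d ∧ |z.2.2| ≤ d := by
  simp [Prod.norm_def]

/-- A symmetric compatible pairing `pair` on a Banach space `V` containing a Euclidean space `E`,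
a symmetric operator `op` whose range is orthogonal to `E`, and a small perturbation
(potential `pot`, gradient `grad`) of the quadratic form `w ↦ pair w w / 2`. -/
structure ReductionData (E V : Type*) [NormedAddCommGroup E] [InnerProductSpace ℝ E]
    [NormedAddCommGroup V] [NormedSpace ℝ V] where
  pair : V →L[ℝ] V →L[ℝ] ℝ
  emb : E →L[ℝ] V
  op : V →L[ℝ] V
  bound : ℝ
  grad : V → V
  pot : V → ℝ
  pair_le : ∀ u v, |pair u v| ≤ ‖u‖ * ‖v‖
  pair_comm : ∀ u v, pair u v = pair v u
  norm_emb_le : ∀ x, ‖emb x‖ ≤ ‖x‖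
  pair_emb : ∀ x y, pair (emb x) (emb y) = ⟪x, y⟫
  one_le_bound : 1 ≤ bound
  norm_op_le : ∀ u, ‖op u‖ ≤ bound * ‖u‖
  pair_op : ∀ u v, pair u (op v) = pair (op u) v
  pair_op_emb : ∀ u x, pair (op u) (emb x) = 0
  grad_zero : grad 0 = 0
  pot_zero : pot 0 = 0
  grad_lip : ∀ w ∈ Metric.closedBall (0 : V) 2, ∀ w' ∈ Metric.closedBall (0 : V) 2,
    ‖grad w - grad w'‖ ≤ (1 / (64 * bound)) ^ 2 * ‖w - w'‖
  pot_lip : ∀ w ∈ Metric.closedBall (0 : V) 2, ∀ w' ∈ Metric.closedBall (0 : V) 2,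
    |pot w - pot w'| ≤ 2 * (1 / (64 * bound)) ^ 2 * ‖w - w'‖
  pot_grad : ∀ w ∈ Metric.closedBall (0 : V) 2, ∀ w' ∈ Metric.closedBall (0 : V) 2,
    |pot w' - pot w - pair (grad w) (w' - w)| ≤ ‖w' - w‖ ^ 2

namespace ReductionData

variable {E V : Type*} [NormedAddCommGroup E] [InnerProductSpace ℝ E]
    [NormedAddCommGroup V] [NormedSpace ℝ V] (D : ReductionData E V)

/-- The radius of the ball on which the fixed point problem is solved. -/
noncomputable def rad : ℝ := 1 / (64 * D.bound)

lemma rad_pos : 0 < D.rad := by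
  have := D.one_le_bound
  unfold rad; positivity

lemma bound_mul_rad : D.bound * D.rad = 1 / 64 := by
  have := D.one_le_bound
  unfold rad; field_simp

lemma rad_le : D.rad ≤ 1 / 64 := by
  have h := D.bound_mul_rad
  nlinarith [D.rad_pos, D.one_le_bound]

/-- The loop `(1 + s) ξ + v`. -/
noncomputable def loop (ξ : E) (v : V) (s : ℝ) : V := (1 + s) • D.emb ξ + v

/-- The updated value of the frequency shift. -/
noncomputable def shift (ξ : E) (v : V) (a s : ℝ) : ℝ :=
  -(a * s) - (1 + a) * D.pair (D.grad (D.loop ξ v s)) (D.emb ξ)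

/-- The updated value of the velocity in the rotating frame. -/
noncomputable def vel (ξ : E) (v : V) (a s : ℝ) : V :=
  D.shift ξ v a s • D.loop ξ v s + (1 + a) • D.grad (D.loop ξ v s)

/-- The updated value of the amplitude shift. -/
noncomputable def amp (ξ : E) (v : V) (s : ℝ) : ℝ :=
  -(s ^ 2 / 2) - D.pair v v / 2 - D.pot (D.loop ξ v s)

variable {D}

lemma loop_mem {ξ : E} {v : V} {s : ℝ} (hξ : ‖ξ‖ ≤ 1) (hv : ‖v‖ ≤ D.rad) (hs : |s| ≤ D.rad) :
    D.loop ξ v s ∈ Metric.closedBall (0 : V) 2 := by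
  rw [mem_closedBall_zero_iff]
  have h1 : ‖(1 + s) • D.emb ξ‖ ≤ (1 + D.rad) * 1 := by
    rw [norm_smul]
    gcongr
    · have := D.rad_pos; linarith
    · calc ‖(1 : ℝ) + s‖ ≤ ‖(1 : ℝ)‖ + ‖s‖ := norm_add_le _ _
        _ ≤ 1 + D.rad := by simpa using hs
    · exact (D.norm_emb_le ξ).trans hξ
  have := D.rad_le
  calc _ ≤ ‖(1 + s) • D.emb ξ‖ + ‖v‖ := norm_add_le _ _
    _ ≤ 2 := by linarith

lemma norm_loop_le {ξ : E} {v : V} {s : ℝ} (hξ : ‖ξ‖ ≤ 1) (hv : ‖v‖ ≤ D.rad)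
    (hs : |s| ≤ D.rad) : ‖D.loop ξ v s‖ ≤ 2 := by
  simpa using loop_mem hξ hv hs

lemma norm_grad_le {w : V} (hw : w ∈ Metric.closedBall (0 : V) 2) :
    ‖D.grad w‖ ≤ 2 * D.rad ^ 2 := by
  have h := D.grad_lip w hw 0 (by simp)
  rw [D.grad_zero, sub_zero, sub_zero] at h
  have h2 : ‖w‖ ≤ 2 := by simpa using hw
  unfold rad
  nlinarith [sq_nonneg (1 / (64 * D.bound))]

lemma abs_pot_le {w : V} (hw : w ∈ Metric.closedBall (0 : V) 2) :
    |D.pot w| ≤ 4 * D.rad ^ 2 := by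
  have h := D.pot_lip w hw 0 (by simp)
  rw [D.pot_zero, sub_zero, sub_zero] at h
  have h2 : ‖w‖ ≤ 2 := by simpa using hw
  unfold rad
  nlinarith [sq_nonneg (1 / (64 * D.bound))]

lemma norm_loop_sub_le {ξ ξ' : E} {v v' : V} {s s' d : ℝ} (hξ' : ‖ξ'‖ ≤ 1)
    (hs : |s| ≤ D.rad) (hdv : ‖v - v'‖ ≤ d) (hds : |s - s'| ≤ d) :
    ‖D.loop ξ v s - D.loop ξ' v' s'‖ ≤ 2 * ‖ξ - ξ'‖ + 2 * d := by
  have e : D.loop ξ v s - D.loop ξ' v' s'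
      = (1 + s) • D.emb (ξ - ξ') + (s - s') • D.emb ξ' + (v - v') := by
    simp only [loop, map_sub]; module
  have h1 : ‖(1 + s) • D.emb (ξ - ξ')‖ ≤ 2 * ‖ξ - ξ'‖ := by
    rw [norm_smul]
    gcongr
    · have := D.rad_le
      rw [Real.norm_eq_abs, abs_le]; rw [abs_le] at hs; constructor <;> linarith
    · exact D.norm_emb_le _
  have h2 : ‖(s - s') • D.emb ξ'‖ ≤ d * 1 := by
    rw [norm_smul]
    have : 0 ≤ d := (norm_nonneg _).trans hdv
    gcongr
    · exact hds
    · exact (D.norm_emb_le _).trans hξ'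
  rw [e]
  refine (norm_add₃_le).trans ?_
  linarith

lemma abs_pair_sub_pair_le {x x' y y' : V} {A B dx dy : ℝ} (hx : ‖x‖ ≤ A) (hy' : ‖y'‖ ≤ B)
    (hdx : ‖x - x'‖ ≤ dx) (hdy : ‖y - y'‖ ≤ dy) :
    |D.pair x y - D.pair x' y'| ≤ A * dy + dx * B := by
  have e : D.pair x y - D.pair x' y' = D.pair x (y - y') + D.pair (x - x') y' := by
    simp
  rw [e]
  refine (abs_add_le _ _).trans ?_
  have := (norm_nonneg x).trans hx
  have := (norm_nonneg _).trans hdx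
  refine add_le_add ((D.pair_le _ _).trans ?_) ((D.pair_le _ _).trans ?_) <;> gcongr

lemma abs_shift_le {ξ : E} {v : V} {a s : ℝ} (hξ : ‖ξ‖ ≤ 1) (hv : ‖v‖ ≤ D.rad)
    (ha : |a| ≤ D.rad) (hs : |s| ≤ D.rad) : |D.shift ξ v a s| ≤ 5 * D.rad ^ 2 := by
  have h0 := D.rad_pos
  have h1 := D.rad_le
  have hp : |D.pair (D.grad (D.loop ξ v s)) (D.emb ξ)| ≤ 2 * D.rad ^ 2 * 1 := by
    refine (D.pair_le _ _).trans ?_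
    gcongr
    · exact norm_grad_le (loop_mem hξ hv hs)
    · exact (D.norm_emb_le _).trans hξ
  have h1a : |1 + a| ≤ 2 := by
    rw [abs_le] at ha ⊢; constructor <;> linarith
  have e1 : |a * s| ≤ D.rad * D.rad := by rw [abs_mul]; gcongr
  have e2 : |(1 + a) * D.pair (D.grad (D.loop ξ v s)) (D.emb ξ)| ≤ 2 * (2 * D.rad ^ 2 * 1) := by
    rw [abs_mul]; gcongr
  unfold shift
  rw [abs_le] at e1 e2 ⊢
  constructor <;> nlinarith

lemma norm_vel_le {ξ : E} {v : V} {a s : ℝ} (hξ : ‖ξ‖ ≤ 1) (hv : ‖v‖ ≤ D.rad)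
    (ha : |a| ≤ D.rad) (hs : |s| ≤ D.rad) : ‖D.vel ξ v a s‖ ≤ 14 * D.rad ^ 2 := by
  have h0 := D.rad_pos
  have h1 := D.rad_le
  have h1a : |1 + a| ≤ 2 := by
    rw [abs_le] at ha ⊢; constructor <;> linarith
  have e1 : ‖D.shift ξ v a s • D.loop ξ v s‖ ≤ 5 * D.rad ^ 2 * 2 := by
    rw [norm_smul]
    gcongr
    · exact abs_shift_le hξ hv ha hs
    · exact norm_loop_le hξ hv hs
  have e2 : ‖(1 + a) • D.grad (D.loop ξ v s)‖ ≤ 2 * (2 * D.rad ^ 2) := by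
    rw [norm_smul]
    gcongr
    · exact h1a
    · exact norm_grad_le (loop_mem hξ hv hs)
  refine (norm_add_le _ _).trans ?_
  linarith

lemma abs_amp_le {ξ : E} {v : V} {s : ℝ} (hξ : ‖ξ‖ ≤ 1) (hv : ‖v‖ ≤ D.rad)
    (hs : |s| ≤ D.rad) : |D.amp ξ v s| ≤ D.rad := by
  have h0 := D.rad_pos
  have h1 := D.rad_le
  have e1 : |D.pair v v| ≤ D.rad * D.rad := (D.pair_le _ _).trans (by gcongr)
  have e2 := abs_pot_le (D := D) (loop_mem hξ hv hs)
  have e3 : s ^ 2 ≤ D.rad ^ 2 := sq_le_sq' (by linarith [(abs_le.1 hs).1]) (abs_le.1 hs).2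
  unfold amp
  rw [abs_le] at e1 e2 ⊢
  constructor <;> nlinarith [sq_nonneg s]

lemma abs_shift_sub_le {ξ ξ' : E} {v v' : V} {a a' s s' d : ℝ}
    (hξ : ‖ξ‖ ≤ 1) (hv : ‖v‖ ≤ D.rad) (ha : |a| ≤ D.rad) (hs : |s| ≤ D.rad)
    (hξ' : ‖ξ'‖ ≤ 1) (hv' : ‖v'‖ ≤ D.rad) (hs' : |s'| ≤ D.rad)
    (hdv : ‖v - v'‖ ≤ d) (hda : |a - a'| ≤ d) (hds : |s - s'| ≤ d) :
    |D.shift ξ v a s - D.shift ξ' v' a' s'|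
      ≤ 8 * D.rad ^ 2 * ‖ξ - ξ'‖ + (2 * D.rad + 6 * D.rad ^ 2) * d := by
  have h0 := D.rad_pos
  have h1 := D.rad_le
  have hw := loop_mem hξ hv hs
  have hw' := loop_mem hξ' hv' hs'
  have hdw := norm_loop_sub_le (D := D) (ξ := ξ) hξ' hs hdv hds
  have h1a : |1 + a| ≤ 2 := by
    rw [abs_le] at ha ⊢; constructor <;> linarith
  have hdG : ‖D.grad (D.loop ξ v s) - D.grad (D.loop ξ' v' s')‖
      ≤ D.rad ^ 2 * (2 * ‖ξ - ξ'‖ + 2 * d) :=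
    (D.grad_lip _ hw _ hw').trans (by unfold rad; gcongr)
  have hdp := abs_pair_sub_pair_le (D := D) (x := D.grad (D.loop ξ v s)) (y := D.emb ξ)
    (y' := D.emb ξ') (norm_grad_le hw) ((D.norm_emb_le _).trans hξ') hdG
    (show ‖D.emb ξ - D.emb ξ'‖ ≤ ‖ξ - ξ'‖ by rw [← map_sub]; exact D.norm_emb_le _)
  have hp' : |D.pair (D.grad (D.loop ξ' v' s')) (D.emb ξ')| ≤ 2 * D.rad ^ 2 * 1 := by
    refine (D.pair_le _ _).trans ?_
    gcongr
    · exact norm_grad_le hw'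
    · exact (D.norm_emb_le _).trans hξ'
  have k1 := abs_mul_sub_mul_le ha hs' hda hds
  have k2 := abs_mul_sub_mul_le h1a hp' (x' := 1 + a') (dx := d) (by simpa using hda) hdp
  unfold shift
  rw [abs_le] at k1 k2 ⊢
  constructor <;> nlinarith

lemma norm_vel_sub_le {ξ ξ' : E} {v v' : V} {a a' s s' d : ℝ}
    (hξ : ‖ξ‖ ≤ 1) (hv : ‖v‖ ≤ D.rad) (ha : |a| ≤ D.rad) (hs : |s| ≤ D.rad)
    (hξ' : ‖ξ'‖ ≤ 1) (hv' : ‖v'‖ ≤ D.rad) (hs' : |s'| ≤ D.rad)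
    (hdv : ‖v - v'‖ ≤ d) (hda : |a - a'| ≤ d) (hds : |s - s'| ≤ d) :
    ‖D.vel ξ v a s - D.vel ξ' v' a' s'‖ ≤ D.rad * ‖ξ - ξ'‖ + 5 * D.rad * d := by
  have h0 := D.rad_pos
  have h1 := D.rad_le
  have hw := loop_mem hξ hv hs
  have hw' := loop_mem hξ' hv' hs'
  have hdw := norm_loop_sub_le (D := D) (ξ := ξ) hξ' hs hdv hds
  have h1a : |1 + a| ≤ 2 := by
    rw [abs_le] at ha ⊢; constructor <;> linarith
  have hdG : ‖D.grad (D.loop ξ v s) - D.grad (D.loop ξ' v' s')‖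
      ≤ D.rad ^ 2 * (2 * ‖ξ - ξ'‖ + 2 * d) :=
    (D.grad_lip _ hw _ hw').trans (by unfold rad; gcongr)
  have k1 := norm_smul_sub_smul_le (abs_shift_le hξ hv ha hs) (norm_loop_le hξ' hv' hs')
    (abs_shift_sub_le hξ hv ha hs hξ' hv' hs' hdv hda hds) hdw
  have k2 := norm_smul_sub_smul_le h1a (norm_grad_le hw') (x' := 1 + a') (dx := d)
    (by simpa using hda) hdG
  have e : D.vel ξ v a s - D.vel ξ' v' a' s' =
    (D.shift ξ v a s • D.loop ξ v s - D.shift ξ' v' a' s' • D.loop ξ' v' s') +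
    ((1 + a) • D.grad (D.loop ξ v s) - (1 + a') • D.grad (D.loop ξ' v' s')) := by
    unfold vel; abel
  rw [e]
  refine (norm_add_le _ _).trans ((add_le_add k1 k2).trans ?_)
  have hd : 0 ≤ d := (norm_nonneg _).trans hdv
  have hr : D.rad ^ 2 ≤ D.rad / 64 := by nlinarith
  have p1 := mul_le_mul_of_nonneg_right hr hd
  have p2 := mul_le_mul_of_nonneg_right hr (norm_nonneg (ξ - ξ'))
  have p3 := mul_nonneg h0.le hd
  have p4 := mul_nonneg h0.le (norm_nonneg (ξ - ξ'))
  nlinarith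

lemma abs_amp_sub_le {ξ ξ' : E} {v v' : V} {s s' d : ℝ}
    (hξ : ‖ξ‖ ≤ 1) (hv : ‖v‖ ≤ D.rad) (hs : |s| ≤ D.rad)
    (hξ' : ‖ξ'‖ ≤ 1) (hv' : ‖v'‖ ≤ D.rad) (hs' : |s'| ≤ D.rad)
    (hdv : ‖v - v'‖ ≤ d) (hds : |s - s'| ≤ d) :
    |D.amp ξ v s - D.amp ξ' v' s'| ≤ ‖ξ - ξ'‖ + d / 2 := by
  have h0 := D.rad_pos
  have h1 := D.rad_le
  have hw := loop_mem hξ hv hs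
  have hw' := loop_mem hξ' hv' hs'
  have hdw := norm_loop_sub_le (D := D) (ξ := ξ) hξ' hs hdv hds
  have k1 := abs_mul_sub_mul_le hs hs' hds hds
  have k2 := abs_pair_sub_pair_le (D := D) hv hv' hdv hdv
  have k3 : |D.pot (D.loop ξ v s) - D.pot (D.loop ξ' v' s')|
      ≤ 2 * D.rad ^ 2 * (2 * ‖ξ - ξ'‖ + 2 * d) :=
    (D.pot_lip _ hw _ hw').trans (by unfold rad; gcongr)
  have hd : 0 ≤ d := (norm_nonneg _).trans hdv
  have hr : D.rad ^ 2 ≤ D.rad / 64 := by nlinarith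
  have p1 := mul_le_mul_of_nonneg_right hr hd
  have p2 := mul_le_mul_of_nonneg_right hr (norm_nonneg (ξ - ξ'))
  have p3 := mul_le_mul_of_nonneg_right h1 hd
  have p4 := mul_le_mul_of_nonneg_right h1 (norm_nonneg (ξ - ξ'))
  have p5 := norm_nonneg (ξ - ξ')
  unfold amp
  rw [abs_le] at k1 k2 k3 ⊢
  constructor <;> nlinarith

variable (D) in
/-- The self-map of the ball of radius `rad` whose fixed point solves the reduced problem in
direction `ξ`. -/
noncomputable def step (ξ : E) (z : V × ℝ × ℝ) : V × ℝ × ℝ :=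
  (D.op (D.vel ξ z.1 z.2.1 z.2.2), D.shift ξ z.1 z.2.1 z.2.2, D.amp ξ z.1 z.2.2)

lemma step_mem {ξ : E} (hξ : ‖ξ‖ ≤ 1) {z : V × ℝ × ℝ} (hz : ‖z‖ ≤ D.rad) :
    ‖D.step ξ z‖ ≤ D.rad := by
  obtain ⟨hv, ha, hs⟩ := norm_triple_le_iff.1 hz
  have h0 := D.rad_pos
  have h1 := D.rad_le
  have h2 := D.bound_mul_rad
  have h3 := D.one_le_bound
  refine norm_triple_le_iff.2 ⟨?_, ?_, abs_amp_le hξ hv hs⟩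
  · refine (D.norm_op_le _).trans ?_
    have := norm_vel_le hξ hv ha hs
    calc _ ≤ D.bound * (14 * D.rad ^ 2) := by gcongr
      _ = 14 * (D.bound * D.rad) * D.rad := by ring
      _ ≤ D.rad := by rw [h2]; linarith
  · exact (abs_shift_le hξ hv ha hs).trans (by nlinarith)

lemma norm_step_sub_le {ξ ξ' : E} (hξ : ‖ξ‖ ≤ 1) (hξ' : ‖ξ'‖ ≤ 1) {z z' : V × ℝ × ℝ}
    (hz : ‖z‖ ≤ D.rad) (hz' : ‖z'‖ ≤ D.rad) :
    ‖D.step ξ z - D.step ξ' z'‖ ≤ ‖ξ - ξ'‖ + ‖z - z'‖ / 2 := by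
  obtain ⟨hv, ha, hs⟩ := norm_triple_le_iff.1 hz
  obtain ⟨hv', ha', hs'⟩ := norm_triple_le_iff.1 hz'
  obtain ⟨hdv, hda, hds⟩ := norm_triple_le_iff.1 (le_refl ‖z - z'‖)
  have h0 := D.rad_pos
  have h1 := D.rad_le
  have h2 := D.bound_mul_rad
  have h3 := D.one_le_bound
  have p5 := norm_nonneg (ξ - ξ')
  have p6 := norm_nonneg (z - z')
  refine norm_triple_le_iff.2 ⟨?_, ?_, abs_amp_sub_le hξ hv hs hξ' hv' hs' hdv hds⟩
  · have := norm_vel_sub_le hξ hv ha hs hξ' hv' hs' hdv hda hds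
    have e : (D.step ξ z - D.step ξ' z').1 =
        D.op (D.vel ξ z.1 z.2.1 z.2.2 - D.vel ξ' z'.1 z'.2.1 z'.2.2) := by
      simp [step]
    rw [e]
    refine (D.norm_op_le _).trans ?_
    calc _ ≤ D.bound * (D.rad * ‖ξ - ξ'‖ + 5 * D.rad * ‖z - z'‖) := by gcongr
      _ = (D.bound * D.rad) * (‖ξ - ξ'‖ + 5 * ‖z - z'‖) := by ring
      _ ≤ _ := by rw [h2]; linarith
  · refine (abs_shift_sub_le hξ hv ha hs hξ' hv' hs' hdv hda hds).trans ?_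
    have hr : D.rad ^ 2 ≤ D.rad / 64 := by nlinarith
    have p1 := mul_le_mul_of_nonneg_right hr p6
    have p2 := mul_le_mul_of_nonneg_right hr p5
    have p3 := mul_le_mul_of_nonneg_right h1 p6
    have p4 := mul_le_mul_of_nonneg_right h1 p5
    nlinarith

lemma exists_fixedPoint [CompleteSpace V] {ξ : E} (hξ : ‖ξ‖ ≤ 1) :
    ∃ z : V × ℝ × ℝ, ‖z‖ ≤ D.rad ∧ D.step ξ z = z := by
  have hmaps : Set.MapsTo (D.step ξ) (Metric.closedBall 0 D.rad) (Metric.closedBall 0 D.rad) := by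
    intro z hz
    rw [mem_closedBall_zero_iff] at hz ⊢
    exact step_mem hξ hz
  have hc : ContractingWith (1 / 2) (hmaps.restrict (D.step ξ) _ _) := by
    refine ⟨by rw [← NNReal.coe_lt_coe]; norm_num, LipschitzWith.of_dist_le_mul ?_⟩
    rintro ⟨z, hz⟩ ⟨z', hz'⟩
    rw [mem_closedBall_zero_iff] at hz hz'
    have := norm_step_sub_le hξ hξ hz hz'
    simp only [sub_self, norm_zero, zero_add] at this
    rw [Subtype.dist_eq, Subtype.dist_eq, dist_eq_norm, dist_eq_norm]
    simpa [div_eq_inv_mul] using this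
  obtain ⟨z, hz, hfix, -⟩ := hc.exists_fixedPoint' Metric.isClosed_closedBall.isComplete hmaps
    (x := 0) (by simpa using D.rad_pos.le) (edist_ne_top _ _)
  exact ⟨z, by simpa using hz, hfix⟩

lemma norm_fixedPoint_sub_le {ξ ξ' : E} (hξ : ‖ξ‖ ≤ 1) (hξ' : ‖ξ'‖ ≤ 1) {z z' : V × ℝ × ℝ}
    (hz : ‖z‖ ≤ D.rad) (hz' : ‖z'‖ ≤ D.rad) (hf : D.step ξ z = z) (hf' : D.step ξ' z' = z') :
    ‖z - z'‖ ≤ 2 * ‖ξ - ξ'‖ := by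
  have := norm_step_sub_le hξ hξ' hz hz'
  rw [hf, hf'] at this
  linarith

/-- The equations satisfied by a fixed point of `step`. -/
lemma fixedPoint_equations {ξ : E} (hξ : ‖ξ‖ = 1) {v : V} {a s : ℝ}
    (hf : D.step ξ (v, a, s) = (v, a, s)) :
    v = D.op (D.vel ξ v a s) ∧
    D.vel ξ v a s = a • D.loop ξ v s + (1 + a) • D.grad (D.loop ξ v s) ∧
    D.pair (D.vel ξ v a s) (D.emb ξ) = 0 ∧
    D.pair (D.loop ξ v s) (D.loop ξ v s) / 2 + D.pot (D.loop ξ v s) = 1 / 2 := by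
  simp only [step, Prod.mk.injEq] at hf
  obtain ⟨h1, h2, h3⟩ := hf
  have hvel : D.vel ξ v a s = a • D.loop ξ v s + (1 + a) • D.grad (D.loop ξ v s) := by
    rw [vel, h2]
  have hv0 : ∀ x, D.pair v (D.emb x) = 0 := fun x => by rw [← h1]; exact D.pair_op_emb _ _
  have hξξ : D.pair (D.emb ξ) (D.emb ξ) = 1 := by
    rw [D.pair_emb, real_inner_self_eq_norm_sq, hξ]; norm_num
  refine ⟨h1.symm, hvel, ?_, ?_⟩
  · have e : D.pair (D.loop ξ v s) (D.emb ξ) = 1 + s := by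
      simp [loop, hv0, hξξ]
    rw [hvel]
    simp only [map_add, map_smul, add_apply, smul_apply,
      e, smul_eq_mul]
    unfold shift at h2
    linarith
  · have e : D.pair (D.loop ξ v s) (D.loop ξ v s) = (1 + s) ^ 2 + D.pair v v := by
      have := D.pair_comm (D.emb ξ) v
      simp only [loop, map_add, map_smul, add_apply,
        smul_apply, smul_eq_mul, hv0, hξξ, this]
      ring
    rw [e]
    unfold amp at h3
    linarith

variable (D) in
/-- The action of a loop with constant part `c`, where `w = c + v` and `v = op u`. -/
noncomputable def action (u v w : V) : ℝ := D.pair u v / 2 + D.pair w w / 2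

/-- First variation of the action among loops of the same energy, along the reduced family. -/
lemma action_variation {u u' v v' w w' c : V} {a X : ℝ} (ha : |a| ≤ 1)
    (hv : v = D.op u) (hv' : v' = D.op u') (hw : ‖w‖ ≤ 2) (hw' : ‖w'‖ ≤ 2)
    (hu : u = a • w + (1 + a) • D.grad w)
    (he : D.pair w w / 2 + D.pot w = D.pair w' w' / 2 + D.pot w')
    (hc : w' - w = c + (v' - v))
    (hdu : ‖u' - u‖ ≤ X) (hdv : ‖v' - v‖ ≤ 2 * X) (hdw : ‖w' - w‖ ≤ 6 * X) :
    -D.pair u c - 200 * X ^ 2 ≤ D.action u' v' w' - D.action u v w := by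
  have hX : 0 ≤ X := (norm_nonneg _).trans hdu
  have e1 : D.pair u' v' = D.pair u v + 2 * D.pair u (v' - v) + D.pair (u' - u) (v' - v) := by
    have : D.pair u' v = D.pair u v' := by rw [hv, hv', D.pair_op, D.pair_comm]
    simp only [map_sub, sub_apply, this]
    ring
  have e2 : D.pair w' w' = D.pair w w + 2 * D.pair w (w' - w) + D.pair (w' - w) (w' - w) := by
    have := D.pair_comm w' w
    simp only [map_sub, sub_apply, this]
    ring
  have e3 : D.pair u (w' - w) = a * D.pair w (w' - w) + (1 + a) * D.pair (D.grad w) (w' - w) := by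
    rw [hu]
    simp
  have e4 : D.pair u (w' - w) = D.pair u c + D.pair u (v' - v) := by rw [hc, map_add]
  have b1 : |D.pair (u' - u) (v' - v)| ≤ X * (2 * X) :=
    (D.pair_le _ _).trans (by gcongr)
  have b2 : |D.pair (w' - w) (w' - w)| ≤ (6 * X) * (6 * X) :=
    (D.pair_le _ _).trans (by gcongr)
  have b3 : |D.pot w' - D.pot w - D.pair (D.grad w) (w' - w)| ≤ (6 * X) ^ 2 :=
    (D.pot_grad w (by simpa using hw) w' (by simpa using hw')).trans (by gcongr)
  have b4 : |D.pair w (w' - w) + D.pair (D.grad w) (w' - w)| ≤ 54 * X ^ 2 := by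
    rw [abs_le] at b2 b3 ⊢
    constructor <;> nlinarith
  have b5 : |(1 + a) * (D.pair w (w' - w) + D.pair (D.grad w) (w' - w))| ≤ 2 * (54 * X ^ 2) := by
    rw [abs_mul]
    gcongr
    rw [abs_le] at ha ⊢
    constructor <;> linarith
  unfold action
  rw [abs_le] at b1 b2 b5
  nlinarith

/-- Along the critical direction the whole mean velocity vanishes. -/
lemma eq_zero_of_sphere_bound {ξ : E} (hξ : ‖ξ‖ = 1) (φ : E →L[ℝ] ℝ) (hφξ : φ ξ = 0) {C : ℝ}
    (h : ∀ ξ' : E, ‖ξ'‖ = 1 → -φ ξ' ≤ C * ‖ξ' - ξ‖ ^ 2) (x : E) : φ x = 0 := by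
  have key : ∀ e : E, ‖e‖ = 1 → ⟪ξ, e⟫ = 0 → φ e = 0 := by
    intro e he hξe
    have hC : ∀ t : ℝ, -(2 * t * φ e) ≤ C * (4 * t ^ 2) := by
      intro t
      have hpos : 0 < 1 + t ^ 2 := by positivity
      set ξ' : E := (1 + t ^ 2)⁻¹ • ((1 - t ^ 2) • ξ + (2 * t) • e) with hξ'
      have n1 : ‖ξ'‖ ^ 2 = 1 := by
        rw [hξ', norm_smul, mul_pow, norm_add_sq_real, norm_smul, norm_smul, inner_smul_left,
          inner_smul_right, hξe, hξ, he]
        simp only [Real.norm_eq_abs, mul_pow, sq_abs]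
        field_simp
        simp
        ring
      have n1' : ‖ξ'‖ = 1 := by
        have := norm_nonneg ξ'
        nlinarith
      have n2 : ‖ξ' - ξ‖ ^ 2 = 4 * t ^ 2 / (1 + t ^ 2) := by
        have : ⟪ξ', ξ⟫ = (1 - t ^ 2) / (1 + t ^ 2) := by
          rw [hξ', inner_smul_left, inner_add_left, inner_smul_left, inner_smul_left,
            real_inner_comm, real_inner_comm ξ e, hξe, real_inner_self_eq_norm_sq, hξ]
          simp
          field_simp
        rw [norm_sub_sq_real, this, n1, hξ]
        field_simp
        ring
      have n3 : φ ξ' = 2 * t * φ e / (1 + t ^ 2) := by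
        rw [hξ', map_smul, map_add, map_smul, map_smul, hφξ]
        simp
        field_simp
      have := h ξ' n1'
      rw [n2, n3, ← neg_div, mul_div_assoc', div_le_div_iff_of_pos_right hpos] at this
      exact this
    have C0 : 0 ≤ C := by nlinarith [hC 1, hC (-1)]
    have h1 := hC (-(φ e) / (4 * C + 1))
    have hp : 0 < 4 * C + 1 := by linarith
    have e1 : -(2 * (-(φ e) / (4 * C + 1)) * φ e) =
        2 * (φ e) ^ 2 * (4 * C + 1) / (4 * C + 1) ^ 2 := by
      field_simp
    have e2 : C * (4 * (-(φ e) / (4 * C + 1)) ^ 2) = 4 * C * (φ e) ^ 2 / (4 * C + 1) ^ 2 := by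
      field_simp
    rw [e1, e2, div_le_div_iff_of_pos_right (by positivity)] at h1
    have : (φ e) ^ 2 ≤ 0 := by nlinarith [sq_nonneg (φ e), mul_nonneg C0 (sq_nonneg (φ e))]
    exact pow_eq_zero_iff (two_ne_zero) |>.1 (le_antisymm this (sq_nonneg _))
  set y := x - ⟪ξ, x⟫ • ξ with hy
  have hφ : φ x = φ y := by rw [hy, map_sub, map_smul, hφξ]; simp
  have hξy : ⟪ξ, y⟫ = 0 := by
    rw [hy, inner_sub_right, inner_smul_right, real_inner_self_eq_norm_sq, hξ]; simp
  rw [hφ]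
  by_cases hy0 : y = 0
  · rw [hy0, map_zero]
  · have := key (‖y‖⁻¹ • y) (norm_smul_inv_norm hy0) (by rw [inner_smul_right, hξy, mul_zero])
    rw [map_smul, smul_eq_mul] at this
    exact (mul_eq_zero.1 this).resolve_left (inv_ne_zero (norm_ne_zero_iff.2 hy0))

/-- The reduced variational problem has a solution. -/
theorem exists_critical [CompleteSpace V] [FiniteDimensional ℝ E] [Nontrivial E]
    (D : ReductionData E V) :
    ∃ (c : E) (u w : V) (a : ℝ), |a| ≤ 1 / 2 ∧ ‖w‖ ≤ 2 ∧ w = D.emb c + D.op u ∧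
      u = a • w + (1 + a) • D.grad w ∧ (∀ x, D.pair u (D.emb x) = 0) ∧
      D.pair w w / 2 + D.pot w = 1 / 2 := by
  have h0 := D.rad_pos
  have h1 := D.rad_le
  have hex : ∀ ξ : E, ∃ z : V × ℝ × ℝ, ‖ξ‖ = 1 → ‖z‖ ≤ D.rad ∧ D.step ξ z = z := by
    intro ξ
    by_cases hξ : ‖ξ‖ = 1
    · obtain ⟨z, hz⟩ := exists_fixedPoint (D := D) hξ.le
      exact ⟨z, fun _ => hz⟩
    · exact ⟨0, fun h => absurd h hξ⟩
  choose z hz using hex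
  set v : E → V := fun ξ => (z ξ).1 with hvdef
  set a : E → ℝ := fun ξ => (z ξ).2.1 with hadef
  set s : E → ℝ := fun ξ => (z ξ).2.2 with hsdef
  set w : E → V := fun ξ => D.loop ξ (v ξ) (s ξ) with hwdef
  set u : E → V := fun ξ => D.vel ξ (v ξ) (a ξ) (s ξ) with hudef
  have hb : ∀ ξ : E, ‖ξ‖ = 1 → ‖v ξ‖ ≤ D.rad ∧ |a ξ| ≤ D.rad ∧ |s ξ| ≤ D.rad :=
    fun ξ hξ => norm_triple_le_iff.1 (hz ξ hξ).1
  have heq : ∀ ξ : E, ‖ξ‖ = 1 → v ξ = D.op (u ξ) ∧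
      u ξ = a ξ • w ξ + (1 + a ξ) • D.grad (w ξ) ∧ D.pair (u ξ) (D.emb ξ) = 0 ∧
      D.pair (w ξ) (w ξ) / 2 + D.pot (w ξ) = 1 / 2 :=
    fun ξ hξ => fixedPoint_equations hξ (hz ξ hξ).2
  have hlip : ∀ ξ ξ' : E, ‖ξ‖ = 1 → ‖ξ'‖ = 1 → ‖v ξ - v ξ'‖ ≤ 2 * ‖ξ - ξ'‖ ∧
      |a ξ - a ξ'| ≤ 2 * ‖ξ - ξ'‖ ∧ |s ξ - s ξ'| ≤ 2 * ‖ξ - ξ'‖ :=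
    fun ξ ξ' hξ hξ' => norm_triple_le_iff.1
      (norm_fixedPoint_sub_le hξ.le hξ'.le (hz ξ hξ).1 (hz ξ' hξ').1 (hz ξ hξ).2 (hz ξ' hξ').2)
  have hwlip : ∀ ξ ξ' : E, ‖ξ‖ = 1 → ‖ξ'‖ = 1 → ‖w ξ - w ξ'‖ ≤ 6 * ‖ξ - ξ'‖ := by
    intro ξ ξ' hξ hξ'
    obtain ⟨l1, l2, l3⟩ := hlip ξ ξ' hξ hξ'
    have := norm_loop_sub_le (D := D) (ξ := ξ) hξ'.le (hb ξ hξ).2.2 l1 l3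
    linarith
  have hulip : ∀ ξ ξ' : E, ‖ξ‖ = 1 → ‖ξ'‖ = 1 → ‖u ξ - u ξ'‖ ≤ ‖ξ - ξ'‖ := by
    intro ξ ξ' hξ hξ'
    obtain ⟨l1, l2, l3⟩ := hlip ξ ξ' hξ hξ'
    obtain ⟨b1, b2, b3⟩ := hb ξ hξ
    obtain ⟨b1', b2', b3'⟩ := hb ξ' hξ'
    refine (norm_vel_sub_le hξ.le b1 b2 b3 hξ'.le b1' b3' l1 l2 l3).trans ?_
    nlinarith [norm_nonneg (ξ - ξ')]
  have hcont : ∀ (g : E → V) (C : NNReal), (∀ ξ ξ' : E, ‖ξ‖ = 1 → ‖ξ'‖ = 1 →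
      ‖g ξ - g ξ'‖ ≤ C * ‖ξ - ξ'‖) → ContinuousOn g (Metric.sphere 0 1) := by
    intro g C hg
    refine (LipschitzOnWith.of_dist_le_mul (K := C) fun ξ hξ ξ' hξ' => ?_).continuousOn
    rw [dist_eq_norm, dist_eq_norm]
    exact hg ξ ξ' (by simpa using hξ) (by simpa using hξ')
  have cv : ContinuousOn v (Metric.sphere 0 1) :=
    hcont v 2 fun ξ ξ' hξ hξ' => by simpa using (hlip ξ ξ' hξ hξ').1
  have cw : ContinuousOn w (Metric.sphere 0 1) :=
    hcont w 6 fun ξ ξ' hξ hξ' => by simpa using hwlip ξ ξ' hξ hξ'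
  have cu : ContinuousOn u (Metric.sphere 0 1) :=
    hcont u 1 fun ξ ξ' hξ hξ' => by simpa using hulip ξ ξ' hξ hξ'
  have cB : ContinuousOn (fun ξ => D.action (u ξ) (v ξ) (w ξ)) (Metric.sphere 0 1) := by
    unfold action
    fun_prop
  obtain ⟨ξ, hξs, hmax⟩ := (isCompact_sphere (0 : E) 1).exists_isMaxOn
    (NormedSpace.sphere_nonempty.2 zero_le_one) cB
  have hξ : ‖ξ‖ = 1 := by simpa using hξs
  obtain ⟨b1, b2, b3⟩ := hb ξ hξ
  obtain ⟨q1, q2, q3, q4⟩ := heq ξ hξ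
  have hzero : ∀ x, ((D.pair (u ξ)).comp D.emb) x = 0 := by
    refine eq_zero_of_sphere_bound hξ _ q3 (C := 400) fun ξ' hξ' => ?_
    obtain ⟨b1', b2', b3'⟩ := hb ξ' hξ'
    obtain ⟨q1', q2', q3', q4'⟩ := heq ξ' hξ'
    have hle : D.action (u ξ') (v ξ') (w ξ') ≤ D.action (u ξ) (v ξ) (w ξ) :=
      hmax (by simpa using hξ')
    have := action_variation (D := D) (c := D.emb ((1 + s ξ') • ξ' - (1 + s ξ) • ξ))
      (X := ‖ξ' - ξ‖) (by linarith) q1 q1' (norm_loop_le hξ.le b1 b3)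
      (norm_loop_le hξ'.le b1' b3') q2 (q4.trans q4'.symm)
      (by simp only [loop, map_sub, map_smul]; abel)
      (hulip ξ' ξ hξ' hξ) (hlip ξ' ξ hξ' hξ).1 (hwlip ξ' ξ hξ' hξ)
    simp only [map_sub, map_smul, q3, smul_eq_mul] at this
    simp only [ContinuousLinearMap.comp_apply]
    by_cases hn : D.pair (u ξ) (D.emb ξ') ≤ 0
    · have hs : 1 / 2 ≤ 1 + s ξ' := by linarith [(abs_le.1 b3').1]
      nlinarith
    · nlinarith [sq_nonneg ‖ξ' - ξ‖]
  refine ⟨(1 + s ξ) • ξ, u ξ, w ξ, a ξ, by linarith, norm_loop_le hξ.le b1 b3, ?_, q2,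
    fun x => hzero x, q4⟩
  rw [← q1, map_smul]
  rfl

end ReductionData

section Rotation

variable {E : Type*} [NormedAddCommGroup E] [InnerProductSpace ℝ E]

/-- A linear complex structure compatible with the inner product. -/
structure IsComplexStructure (J : E →L[ℝ] E) : Prop where
  sq : ∀ x, J (J x) = -x
  skew : ∀ x y, ⟪J x, y⟫ = -⟪x, J y⟫

/-- The rotation `exp (2 π s J)`. -/
noncomputable def rot (J : E →L[ℝ] E) (s : ℝ) : E →L[ℝ] E :=
  Real.cos (2 * Real.pi * s) • ContinuousLinearMap.id ℝ E + Real.sin (2 * Real.pi * s) • J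

variable {J : E →L[ℝ] E}

lemma rot_apply (s : ℝ) (x : E) :
    rot J s x = Real.cos (2 * Real.pi * s) • x + Real.sin (2 * Real.pi * s) • J x := by
  simp [rot]

lemma rot_neg_rot (hJ : IsComplexStructure J) (s : ℝ) (x : E) : rot J (-s) (rot J s x) = x := by
  simp only [rot_apply, mul_neg, Real.cos_neg, Real.sin_neg, map_add, map_smul, hJ.sq]
  linear_combination (norm := module) (Real.sin_sq_add_cos_sq (2 * Real.pi * s)) • x

lemma rot_rot_neg (hJ : IsComplexStructure J) (s : ℝ) (x : E) : rot J s (rot J (-s) x) = x := by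
  simpa using rot_neg_rot hJ (-s) x

lemma inner_J_self (hJ : IsComplexStructure J) (x : E) : ⟪x, J x⟫ = 0 := by
  have := hJ.skew x x
  rw [real_inner_comm] at this
  linarith

lemma norm_J (hJ : IsComplexStructure J) (x : E) : ‖J x‖ = ‖x‖ := by
  have : ⟪J x, J x⟫ = ⟪x, x⟫ := by rw [hJ.skew, hJ.sq, inner_neg_right, neg_neg]
  rw [real_inner_self_eq_norm_sq, real_inner_self_eq_norm_sq] at this
  exact (pow_left_inj₀ (norm_nonneg _) (norm_nonneg _) two_ne_zero).1 this

lemma inner_rot_left (hJ : IsComplexStructure J) (s : ℝ) (x y : E) :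
    ⟪rot J s x, y⟫ = ⟪x, rot J (-s) y⟫ := by
  simp only [rot_apply, mul_neg, Real.cos_neg, Real.sin_neg, inner_add_left, inner_add_right,
    inner_smul_left, inner_smul_right, hJ.skew]
  simp

lemma norm_rot (hJ : IsComplexStructure J) (s : ℝ) (x : E) : ‖rot J s x‖ = ‖x‖ := by
  have : ⟪rot J s x, rot J s x⟫ = ⟪x, x⟫ := by rw [inner_rot_left hJ, rot_neg_rot hJ]
  rw [real_inner_self_eq_norm_sq, real_inner_self_eq_norm_sq] at this
  exact (pow_left_inj₀ (norm_nonneg _) (norm_nonneg _) two_ne_zero).1 this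

lemma rot_add_one (s : ℝ) (x : E) : rot J (s + 1) x = rot J s x := by
  simp only [rot_apply, mul_add, mul_one, Real.cos_add_two_pi, Real.sin_add_two_pi]

lemma rot_neg_add_one (s : ℝ) (x : E) : rot J (-(s + 1)) x = rot J (-s) x := by
  rw [← rot_add_one (-(s + 1)) x]; congr 2; ring

lemma continuous_rot : Continuous (rot J) := by
  unfold rot; fun_prop

lemma J_rot (s : ℝ) (x : E) : rot J s (J x) = J (rot J s x) := by
  simp [rot_apply]

lemma hasDerivAt_rot (hJ : IsComplexStructure J) {W : ℝ → E} {W' : E} {s : ℝ}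
    (hW : HasDerivAt W W' s) :
    HasDerivAt (fun t => rot J t (W t))
      ((2 * Real.pi) • J (rot J s (W s)) + rot J s W') s := by
  have h1 : HasDerivAt (fun t : ℝ => 2 * Real.pi * t) (2 * Real.pi) s := by
    simpa using (hasDerivAt_id s).const_mul (2 * Real.pi)
  have h2 := (h1.cos.smul hW).add (h1.sin.smul (J.hasFDerivAt.comp_hasDerivAt s hW))
  simp only [rot_apply]
  refine h2.congr_deriv ?_
  simp only [map_add, map_smul, hJ.sq, Function.comp]
  module

end Rotation

section Loops

open MeasureTheory

variable {E : Type*} [NormedAddCommGroup E]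

/-- A continuous `1`-periodic function, as a function on the circle. -/
def circleLift (F : ℝ → E) (hF : Continuous F) (hp : Function.Periodic F 1) :
    C(UnitAddCircle, E) where
  toFun := hp.lift
  continuous_toFun := continuous_coinduced_dom.2 hF

@[simp] lemma circleLift_coe (F : ℝ → E) (hF : Continuous F) (hp : Function.Periodic F 1) (s : ℝ) :
    circleLift F hF hp (s : UnitAddCircle) = F s := rfl

lemma norm_circle_le {u : C(UnitAddCircle, E)} {C : ℝ}
    (h : ∀ s ∈ Set.Icc (0 : ℝ) 1, ‖u (s : UnitAddCircle)‖ ≤ C) : ‖u‖ ≤ C := by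
  have hC : 0 ≤ C := (norm_nonneg _).trans (h 0 (by simp))
  refine (ContinuousMap.norm_le _ hC).2 fun x => ?_
  obtain ⟨s, hs, rfl⟩ := AddCircle.eq_coe_Ico x
  exact h s ⟨hs.1, hs.2.le⟩

lemma norm_coe_le (u : C(UnitAddCircle, E)) (s : ℝ) : ‖u (s : UnitAddCircle)‖ ≤ ‖u‖ :=
  u.norm_coe_le_norm _

@[fun_prop] lemma continuous_coe (u : C(UnitAddCircle, E)) :
    Continuous fun s : ℝ => u (s : UnitAddCircle) :=
  u.continuous.comp continuous_quotient_mk'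

lemma circle_ext {u v : C(UnitAddCircle, E)} (h : ∀ s : ℝ, u (s : UnitAddCircle) = v s) :
    u = v := by
  ext x
  obtain ⟨s, -, rfl⟩ := AddCircle.eq_coe_Ico x
  exact h s

lemma norm_integral_le {G : Type*} [NormedAddCommGroup G] [NormedSpace ℝ G] {F : ℝ → G} {C : ℝ}
    (h : ∀ s ∈ Set.Icc (0 : ℝ) 1, ‖F s‖ ≤ C) : ‖∫ s in (0 : ℝ)..1, F s‖ ≤ C := by
  have := intervalIntegral.norm_integral_le_of_norm_le_const (a := 0) (b := 1) (f := F) (C := C)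
    fun s hs => h s (by rw [Set.uIoc_of_le zero_le_one] at hs; exact ⟨hs.1.le, hs.2⟩)
  simpa using this

lemma intervalIntegrable_of_continuous {F : Type*} [NormedAddCommGroup F] {f : ℝ → F}
    (h : Continuous f) {a b : ℝ} : IntervalIntegrable f volume a b := h.intervalIntegrable a b

variable [InnerProductSpace ℝ E]

/-- The `L²` pairing of loops. -/
noncomputable def loopPair : C(UnitAddCircle, E) →L[ℝ] C(UnitAddCircle, E) →L[ℝ] ℝ :=
  LinearMap.mkContinuous₂
    (LinearMap.mk₂ ℝ (fun u v => ∫ s in (0 : ℝ)..1, ⟪u (s : UnitAddCircle), v (s : UnitAddCircle)⟫)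
      (fun u u' v => by
        simp only [ContinuousMap.add_apply, inner_add_left]
        exact intervalIntegral.integral_add (intervalIntegrable_of_continuous (by fun_prop))
          (intervalIntegrable_of_continuous (by fun_prop)))
      (fun c u v => by simp [inner_smul_left])
      (fun u v v' => by
        simp only [ContinuousMap.add_apply, inner_add_right]
        exact intervalIntegral.integral_add (intervalIntegrable_of_continuous (by fun_prop))
          (intervalIntegrable_of_continuous (by fun_prop)))
      (fun c u v => by simp [inner_smul_right]))
    1 fun u v => by
      rw [one_mul]
      refine norm_integral_le fun s _ => (norm_inner_le_norm _ _).trans ?_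
      gcongr <;> apply norm_coe_le

lemma loopPair_apply (u v : C(UnitAddCircle, E)) :
    loopPair u v = ∫ s in (0 : ℝ)..1, ⟪u (s : UnitAddCircle), v (s : UnitAddCircle)⟫ := rfl

/-- Constant loops. -/
noncomputable def loopConst : E →L[ℝ] C(UnitAddCircle, E) :=
  LinearMap.mkContinuous
    { toFun := fun x => ContinuousMap.const _ x
      map_add' := fun _ _ => rfl
      map_smul' := fun _ _ => rfl } 1 fun x => by
      rw [one_mul]
      exact norm_circle_le fun s _ => le_rfl

@[simp] lemma loopConst_apply (x : E) (s : UnitAddCircle) : loopConst x s = x := rfl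

/-- The mean of a loop. -/
noncomputable def loopMean (u : C(UnitAddCircle, E)) : E := ∫ s in (0 : ℝ)..1, u (s : UnitAddCircle)

lemma norm_loopMean_le (u : C(UnitAddCircle, E)) : ‖loopMean u‖ ≤ ‖u‖ :=
  norm_integral_le fun s _ => norm_coe_le u s

/-- The primitive of `u - loopMean u` vanishing at `0`. -/
noncomputable def rawPrim (u : C(UnitAddCircle, E)) (s : ℝ) : E :=
  ∫ t in (0 : ℝ)..s, (u (t : UnitAddCircle) - loopMean u)

/-- The primitive of `u - loopMean u` with vanishing mean. -/
noncomputable def loopPrim (u : C(UnitAddCircle, E)) (s : ℝ) : E :=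
  rawPrim u s - ∫ r in (0 : ℝ)..1, rawPrim u r

lemma loopMean_add (u v : C(UnitAddCircle, E)) : loopMean (u + v) = loopMean u + loopMean v :=
  intervalIntegral.integral_add (intervalIntegrable_of_continuous (by fun_prop))
    (intervalIntegrable_of_continuous (by fun_prop))

lemma loopMean_smul (c : ℝ) (u : C(UnitAddCircle, E)) : loopMean (c • u) = c • loopMean u := by
  simp [loopMean]

lemma norm_loopPrim_le (u : C(UnitAddCircle, E)) {s : ℝ} (hs : s ∈ Set.Icc (0 : ℝ) 1) :
    ‖loopPrim u s‖ ≤ 4 * ‖u‖ := by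
  have h : ∀ r ∈ Set.Icc (0 : ℝ) 1, ‖rawPrim u r‖ ≤ 2 * ‖u‖ := by
    intro r hr
    have := intervalIntegral.norm_integral_le_of_norm_le_const (a := 0) (b := r)
      (f := fun t : ℝ => u (t : UnitAddCircle) - loopMean u) (C := 2 * ‖u‖) fun t _ => by
        refine (norm_sub_le _ _).trans ?_
        linarith [norm_coe_le u t, norm_loopMean_le u]
    refine this.trans ?_
    rw [sub_zero, abs_of_nonneg hr.1]
    nlinarith [norm_nonneg u, hr.2]
  refine (norm_sub_le _ _).trans ?_
  linarith [h s hs, norm_integral_le h]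

lemma loopPair_comm (u v : C(UnitAddCircle, E)) : loopPair u v = loopPair v u := by
  simp only [loopPair_apply, real_inner_comm]

lemma rawPrim_add (u v : C(UnitAddCircle, E)) (s : ℝ) :
    rawPrim (u + v) s = rawPrim u s + rawPrim v s := by
  unfold rawPrim
  rw [← intervalIntegral.integral_add (intervalIntegrable_of_continuous (by fun_prop))
    (intervalIntegrable_of_continuous (by fun_prop))]
  simp only [loopMean_add, ContinuousMap.add_apply]
  congr 1; ext t; abel

lemma rawPrim_smul (c : ℝ) (u : C(UnitAddCircle, E)) (s : ℝ) :
    rawPrim (c • u) s = c • rawPrim u s := by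
  unfold rawPrim
  rw [← intervalIntegral.integral_smul]
  simp only [loopMean_smul, ContinuousMap.smul_apply, smul_sub]

lemma loopPrim_smul (c : ℝ) (u : C(UnitAddCircle, E)) (s : ℝ) :
    loopPrim (c • u) s = c • loopPrim u s := by
  simp only [loopPrim, rawPrim_smul, intervalIntegral.integral_smul, smul_sub]

variable [CompleteSpace E]

lemma hasDerivAt_rawPrim (u : C(UnitAddCircle, E)) (s : ℝ) :
    HasDerivAt (rawPrim u) (u (s : UnitAddCircle) - loopMean u) s := by
  have hc : Continuous fun t : ℝ => u (t : UnitAddCircle) - loopMean u := by fun_prop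
  exact intervalIntegral.integral_hasDerivAt_right (hc.intervalIntegrable _ _)
    (hc.stronglyMeasurableAtFilter _ _) hc.continuousAt

lemma hasDerivAt_loopPrim (u : C(UnitAddCircle, E)) (s : ℝ) :
    HasDerivAt (loopPrim u) (u (s : UnitAddCircle) - loopMean u) s :=
  (hasDerivAt_rawPrim u s).sub_const _

@[fun_prop] lemma continuous_rawPrim (u : C(UnitAddCircle, E)) : Continuous (rawPrim u) :=
  continuous_iff_continuousAt.2 fun s => (hasDerivAt_rawPrim u s).continuousAt

@[fun_prop] lemma continuous_loopPrim (u : C(UnitAddCircle, E)) : Continuous (loopPrim u) :=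
  continuous_iff_continuousAt.2 fun s => (hasDerivAt_loopPrim u s).continuousAt

lemma loopPrim_periodic (u : C(UnitAddCircle, E)) : Function.Periodic (loopPrim u) 1 := by
  intro s
  have hc : Continuous fun t : ℝ => u (t : UnitAddCircle) - loopMean u := by fun_prop
  have hp : Function.Periodic (fun t : ℝ => u (t : UnitAddCircle) - loopMean u) 1 := fun t => by
    simp only [AddCircle.coe_add_period]
  have h1 : ∫ t in s..(s + 1), (u (t : UnitAddCircle) - loopMean u) = 0 := by
    rw [hp.intervalIntegral_add_eq s 0, zero_add, intervalIntegral.integral_sub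
      (intervalIntegrable_of_continuous (by fun_prop)) (by simp)]
    simp [loopMean]
  have h2 := intervalIntegral.integral_add_adjacent_intervals (μ := volume)
    (hc.intervalIntegrable 0 s) (hc.intervalIntegrable s (s + 1))
  rw [h1, add_zero] at h2
  simp only [loopPrim, rawPrim, ← h2]

lemma integral_loopPrim (u : C(UnitAddCircle, E)) : ∫ s in (0 : ℝ)..1, loopPrim u s = 0 := by
  simp only [loopPrim]
  rw [intervalIntegral.integral_sub (intervalIntegrable_of_continuous (by fun_prop)) (by simp)]
  simp

lemma loopPrim_add (u v : C(UnitAddCircle, E)) (s : ℝ) :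
    loopPrim (u + v) s = loopPrim u s + loopPrim v s := by
  simp only [loopPrim, rawPrim_add]
  rw [intervalIntegral.integral_add (intervalIntegrable_of_continuous (by fun_prop))
    (intervalIntegrable_of_continuous (by fun_prop))]
  abel

/-- The inverse of `-(2 π)⁻¹ J d/ds` on loops of mean zero, extended by zero to constants. -/
noncomputable def loopOp (J : E →L[ℝ] E) (hJ : IsComplexStructure J) :
    C(UnitAddCircle, E) →L[ℝ] C(UnitAddCircle, E) :=
  LinearMap.mkContinuous
    { toFun := fun u => circleLift (fun s => (2 * Real.pi) • J (loopPrim u s)) (by fun_prop)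
        ((loopPrim_periodic u).comp fun x => (2 * Real.pi) • J x)
      map_add' := fun u v => circle_ext fun s => by
        rw [ContinuousMap.add_apply]
        simp only [circleLift_coe, loopPrim_add, map_add, smul_add]
      map_smul' := fun c u => circle_ext fun s => by
        rw [ContinuousMap.smul_apply]
        simp only [circleLift_coe, loopPrim_smul, map_smul, RingHom.id_apply,
          smul_comm c (2 * Real.pi)] }
    (8 * Real.pi) fun u => norm_circle_le fun s hs => by
      change ‖(2 * Real.pi) • J (loopPrim u s)‖ ≤ _
      rw [norm_smul, norm_J hJ, Real.norm_of_nonneg (by positivity)]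
      have := norm_loopPrim_le u hs
      have := Real.pi_pos
      nlinarith

lemma loopOp_apply (J : E →L[ℝ] E) (hJ : IsComplexStructure J) (u : C(UnitAddCircle, E)) (s : ℝ) :
    loopOp J hJ u (s : UnitAddCircle) = (2 * Real.pi) • J (loopPrim u s) := rfl

lemma norm_loopOp_le (J : E →L[ℝ] E) (hJ : IsComplexStructure J) (u : C(UnitAddCircle, E)) :
    ‖loopOp J hJ u‖ ≤ 8 * Real.pi * ‖u‖ :=
  ContinuousLinearMap.le_of_opNorm_le _
    (LinearMap.mkContinuous_norm_le _ (by positivity) _) u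

lemma loopPair_loopOp_const (J : E →L[ℝ] E) (hJ : IsComplexStructure J) (u : C(UnitAddCircle, E))
    (x : E) : loopPair (loopOp J hJ u) (loopConst x) = 0 := by
  have e : ∀ s : ℝ, ⟪loopOp J hJ u (s : UnitAddCircle), loopConst x (s : UnitAddCircle)⟫
      = -(2 * Real.pi) * ⟪J x, loopPrim u s⟫ := fun s => by
    rw [loopOp_apply, loopConst_apply, inner_smul_left, hJ.skew, real_inner_comm]
    simp
  simp only [loopPair_apply, e]
  rw [intervalIntegral.integral_const_mul]
  have := (innerSL ℝ (J x)).intervalIntegral_comp_comm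
    (intervalIntegrable_of_continuous (continuous_loopPrim u) (a := 0) (b := 1))
  rw [integral_loopPrim, map_zero] at this
  simp only [innerSL_apply_apply] at this
  rw [this, mul_zero]

lemma loopPair_loopOp (J : E →L[ℝ] E) (hJ : IsComplexStructure J) (u v : C(UnitAddCircle, E)) :
    loopPair u (loopOp J hJ v) = loopPair (loopOp J hJ u) v := by
  have h0 : ∀ (u v : C(UnitAddCircle, E)), loopPair u (loopOp J hJ v) =
      (2 * Real.pi) * ∫ s in (0 : ℝ)..1,
        ⟪u (s : UnitAddCircle) - loopMean u, J (loopPrim v s)⟫ := by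
    intro u v
    have := loopPair_loopOp_const J hJ v (loopMean u)
    rw [loopPair_comm] at this
    have e : loopPair u (loopOp J hJ v) =
        loopPair (u - loopConst (loopMean u)) (loopOp J hJ v) := by
      rw [map_sub, sub_apply, this, sub_zero]
    rw [e, loopPair_apply, ← intervalIntegral.integral_const_mul]
    simp only [loopOp_apply, inner_smul_right, ContinuousMap.sub_apply, loopConst_apply]
  have hd : ∀ s : ℝ, HasDerivAt (fun s => ⟪loopPrim u s, J (loopPrim v s)⟫)
      (⟪loopPrim u s, J (v (s : UnitAddCircle) - loopMean v)⟫ +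
        ⟪u (s : UnitAddCircle) - loopMean u, J (loopPrim v s)⟫) s := fun s =>
    (hasDerivAt_loopPrim u s).inner ℝ (J.hasFDerivAt.comp_hasDerivAt s (hasDerivAt_loopPrim v s))
  have hi := intervalIntegral.integral_eq_sub_of_hasDerivAt (a := 0) (b := 1) (fun s _ => hd s)
    (intervalIntegrable_of_continuous (by fun_prop))
  rw [intervalIntegral.integral_add (intervalIntegrable_of_continuous (by fun_prop))
    (intervalIntegrable_of_continuous (by fun_prop))] at hi
  have p1 := loopPrim_periodic u 0
  have p2 := loopPrim_periodic v 0
  rw [zero_add] at p1 p2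
  rw [p1, p2, sub_self] at hi
  rw [loopPair_comm (loopOp J hJ u) v, h0 u v, h0 v u]
  congr 1
  rw [← neg_eq_of_add_eq_zero_right hi, ← intervalIntegral.integral_neg]
  congr 1
  ext s
  rw [← hJ.skew, real_inner_comm]

end Loops

section Hamiltonian

open MeasureTheory

variable {E : Type*} [NormedAddCommGroup E] [InnerProductSpace ℝ E]

/-- A function `F` with gradient `A` which on the ball of radius `2` is `δ`-close in `C²`
(in the Lipschitz sense) to `x ↦ ‖x‖² / 2`. -/
structure IsNearQuadratic (F : E → ℝ) (A : E → E) (δ : ℝ) : Prop where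
  hasFDerivAt : ∀ x, HasFDerivAt F (innerSL ℝ (A x)) x
  cont : Continuous A
  zero : F 0 = 0
  grad_zero : A 0 = 0
  lip : ∀ x ∈ Metric.closedBall (0 : E) 2, ∀ y ∈ Metric.closedBall (0 : E) 2,
    ‖(A x - x) - (A y - y)‖ ≤ δ * ‖x - y‖

namespace IsNearQuadratic

variable {F : E → ℝ} {A : E → E} {δ : ℝ}

lemma continuous (h : IsNearQuadratic F A δ) : Continuous F :=
  continuous_iff_continuousAt.2 fun x => (h.hasFDerivAt x).continuousAt

lemma hasFDerivAt_sub (h : IsNearQuadratic F A δ) (x : E) :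
    HasFDerivAt (fun y => F y - ‖y‖ ^ 2 / 2) (innerSL ℝ (A x - x)) x := by
  have h1 : HasFDerivAt (fun y : E => ‖y‖ ^ 2 / 2) (innerSL ℝ x) x := by
    have := (hasStrictFDerivAt_norm_sq x).hasFDerivAt.const_mul (1 / 2 : ℝ)
    refine (this.congr_fderiv ?_).congr_of_eventuallyEq ?_
    · ext y; simp
    · exact Filter.Eventually.of_forall fun y => by simp; ring
  rw [map_sub]
  exact (h.hasFDerivAt x).sub h1

lemma abs_sub_le (h : IsNearQuadratic F A δ) (hδ : 0 ≤ δ) {x y : E}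
    (hx : x ∈ Metric.closedBall (0 : E) 2) (hy : y ∈ Metric.closedBall (0 : E) 2) :
    |(F x - ‖x‖ ^ 2 / 2) - (F y - ‖y‖ ^ 2 / 2)| ≤ 2 * δ * ‖x - y‖ := by
  refine (convex_closedBall (0 : E) 2).norm_image_sub_le_of_norm_hasFDerivWithin_le
    (f := fun y => F y - ‖y‖ ^ 2 / 2)
    (fun z _ => (h.hasFDerivAt_sub z).hasFDerivWithinAt) (fun z hz => ?_) hy hx
  rw [innerSL_apply_norm]
  have := h.lip z hz 0 (by simp)
  rw [h.grad_zero, sub_zero, sub_zero, sub_zero] at this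
  have hz2 : ‖z‖ ≤ 2 := by simpa using hz
  nlinarith

lemma abs_taylor_le (h : IsNearQuadratic F A δ) (hδ1 : δ ≤ 1) {x y : E}
    (hx : x ∈ Metric.closedBall (0 : E) 2) (hy : y ∈ Metric.closedBall (0 : E) 2) :
    |(F y - ‖y‖ ^ 2 / 2) - (F x - ‖x‖ ^ 2 / 2) - ⟪A x - x, y - x⟫| ≤ ‖y - x‖ ^ 2 := by
  have := ((convex_closedBall (0 : E) 2).inter
    (convex_closedBall x ‖y - x‖)).norm_image_sub_le_of_norm_hasFDerivWithin_le'
    (f := fun y => F y - ‖y‖ ^ 2 / 2) (φ := innerSL ℝ (A x - x)) (C := ‖y - x‖)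
    (fun z _ => (h.hasFDerivAt_sub z).hasFDerivWithinAt) (fun z hz => ?_)
    ⟨hx, by simp⟩ ⟨hy, by simp [dist_eq_norm]⟩
  · rwa [Real.norm_eq_abs, innerSL_apply_apply, ← sq] at this
  · rw [← map_sub, innerSL_apply_norm]
    have h2 : ‖z - x‖ ≤ ‖y - x‖ := by simpa [dist_eq_norm] using hz.2
    refine (h.lip z hz.1 x hx).trans ?_
    nlinarith [norm_nonneg (z - x)]

end IsNearQuadratic

/-- The constant of closeness to the harmonic oscillator that suffices for the reduction. -/
noncomputable def nearConst : ℝ := (1 / (64 * (8 * Real.pi))) ^ 2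

lemma nearConst_pos : 0 < nearConst := by
  unfold nearConst; have := Real.pi_pos; positivity

lemma nearConst_le : nearConst ≤ 1 / 2 := by
  have h : 1 / (64 * (8 * Real.pi)) ≤ 1 / 2 := by
    gcongr
    linarith [Real.pi_gt_three]
  have h0 : 0 ≤ 1 / (64 * (8 * Real.pi)) := by have := Real.pi_pos; positivity
  unfold nearConst
  nlinarith

variable {J : E →L[ℝ] E} {F : E → ℝ} {A : E → E}

@[fun_prop] lemma continuous_rot_comp {f : ℝ → ℝ} {g : ℝ → E} (hf : Continuous f)
    (hg : Continuous g) : Continuous fun s => rot J (f s) (g s) :=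
  (continuous_rot.comp hf).clm_apply hg

lemma rot_mem_closedBall (hJ : IsComplexStructure J) {w : C(UnitAddCircle, E)}
    (hw : w ∈ Metric.closedBall (0 : C(UnitAddCircle, E)) 2) (s : ℝ) :
    rot J s (w (s : UnitAddCircle)) ∈ Metric.closedBall (0 : E) 2 := by
  rw [mem_closedBall_zero_iff] at hw ⊢
  rw [norm_rot hJ]
  exact (norm_coe_le w s).trans hw

/-- The gradient of the perturbation in the rotating frame. -/
noncomputable def rotGrad (J : E →L[ℝ] E) (A : E → E) (hA : Continuous A)
    (w : C(UnitAddCircle, E)) : C(UnitAddCircle, E) :=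
  circleLift (fun s => rot J (-s) (A (rot J s (w (s : UnitAddCircle))) -
      rot J s (w (s : UnitAddCircle)))) (by fun_prop)
    fun s => by
      simp only [AddCircle.coe_add_period, rot_add_one, rot_neg_add_one]

lemma rotGrad_apply (hA : Continuous A) (w : C(UnitAddCircle, E)) (s : ℝ) :
    rotGrad J A hA w (s : UnitAddCircle) = rot J (-s) (A (rot J s (w (s : UnitAddCircle))) -
      rot J s (w (s : UnitAddCircle))) := rfl

/-- The mean of the perturbation in the rotating frame. -/
noncomputable def rotPot (J : E →L[ℝ] E) (F : E → ℝ) (w : C(UnitAddCircle, E)) : ℝ :=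
  ∫ s in (0 : ℝ)..1, (F (rot J s (w (s : UnitAddCircle))) -
    ‖rot J s (w (s : UnitAddCircle))‖ ^ 2 / 2)

/-- The reduction data of a Hamiltonian close to the harmonic oscillator. -/
noncomputable def hamiltonianData [CompleteSpace E] (hJ : IsComplexStructure J)
    (h : IsNearQuadratic F A nearConst) : ReductionData E C(UnitAddCircle, E) where
  pair := loopPair
  emb := loopConst
  op := loopOp J hJ
  bound := 8 * Real.pi
  grad := rotGrad J A h.cont
  pot := rotPot J F
  pair_le u v := by
    rw [loopPair_apply, ← Real.norm_eq_abs]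
    refine norm_integral_le fun s _ => (norm_inner_le_norm _ _).trans ?_
    gcongr <;> apply norm_coe_le
  pair_comm := loopPair_comm
  norm_emb_le x := norm_circle_le fun s _ => le_rfl
  pair_emb x y := by simp [loopPair_apply]
  one_le_bound := by linarith [Real.pi_gt_three]
  norm_op_le := norm_loopOp_le J hJ
  pair_op := loopPair_loopOp J hJ
  pair_op_emb := loopPair_loopOp_const J hJ
  grad_zero := circle_ext fun s => by simp [rotGrad_apply, h.grad_zero]
  pot_zero := by simp [rotPot, h.zero]
  grad_lip w hw w' hw' := norm_circle_le fun s _ => by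
    rw [ContinuousMap.sub_apply, rotGrad_apply, rotGrad_apply, ← map_sub, norm_rot hJ]
    refine (h.lip _ (rot_mem_closedBall hJ hw s) _ (rot_mem_closedBall hJ hw' s)).trans ?_
    rw [← map_sub, norm_rot hJ, ← ContinuousMap.sub_apply]
    exact mul_le_mul_of_nonneg_left (norm_coe_le _ s) nearConst_pos.le
  pot_lip w hw w' hw' := by
    have hc := h.continuous
    rw [rotPot, rotPot, ← intervalIntegral.integral_sub
      (intervalIntegrable_of_continuous (by fun_prop))
      (intervalIntegrable_of_continuous (by fun_prop)), ← Real.norm_eq_abs]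
    refine norm_integral_le fun s _ => ?_
    refine (h.abs_sub_le nearConst_pos.le (rot_mem_closedBall hJ hw s)
      (rot_mem_closedBall hJ hw' s)).trans ?_
    rw [← map_sub, norm_rot hJ, ← ContinuousMap.sub_apply]
    exact mul_le_mul_of_nonneg_left (norm_coe_le _ s) (by linarith [nearConst_pos])
  pot_grad w hw w' hw' := by
    have hc := h.continuous
    rw [rotPot, rotPot, loopPair_apply, ← intervalIntegral.integral_sub
      (intervalIntegrable_of_continuous (by fun_prop))
      (intervalIntegrable_of_continuous (by fun_prop)), ← intervalIntegral.integral_sub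
      (intervalIntegrable_of_continuous (by fun_prop))
      (intervalIntegrable_of_continuous (by fun_prop)), ← Real.norm_eq_abs]
    refine norm_integral_le fun s _ => ?_
    have := h.abs_taylor_le (by linarith [nearConst_le])
      (rot_mem_closedBall hJ hw s) (rot_mem_closedBall hJ hw' s)
    rw [← map_sub, norm_rot hJ s (_ - _), ← neg_neg s, ← inner_rot_left hJ, neg_neg] at this
    rw [rotGrad_apply, ContinuousMap.sub_apply, Real.norm_eq_abs]
    refine this.trans ?_
    gcongr
    exact norm_coe_le (w' - w) s

/-- A Hamiltonian close to the harmonic oscillator has a periodic orbit on the level `1 / 2`. -/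
theorem IsNearQuadratic.exists_periodic [FiniteDimensional ℝ E] [Nontrivial E]
    (hJ : IsComplexStructure J) (h : IsNearQuadratic F A nearConst) :
    ∃ (x : ℝ → E) (κ : ℝ), 0 < κ ∧ (∀ s, HasDerivAt x (κ • J (A (x s))) s) ∧
      (∀ s, F (x s) = 1 / 2) ∧ (∀ s, x (s + 1) = x s) ∧ ∃ s t, x s ≠ x t := by
  have : CompleteSpace E := FiniteDimensional.complete ℝ E
  obtain ⟨c, u, w, a, ha, hw2, hw, hu, hmean, hen⟩ := (hamiltonianData hJ h).exists_critical
  change w = loopConst c + loopOp J hJ u at hw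
  change u = a • w + (1 + a) • rotGrad J A h.cont w at hu
  change ∀ x, loopPair u (loopConst x) = 0 at hmean
  change loopPair w w / 2 + rotPot J F w = 1 / 2 at hen
  have hu0 : loopMean u = 0 := by
    have h1 := (innerSL ℝ (loopMean u)).intervalIntegral_comp_comm
      (intervalIntegrable_of_continuous (continuous_coe u) (a := 0) (b := 1))
    have h2 := hmean (loopMean u)
    rw [loopPair_comm, loopPair_apply] at h2
    simp only [innerSL_apply_apply] at h1
    simp only [loopConst_apply] at h2
    rw [h2] at h1
    exact inner_self_eq_zero.1 h1.symm
  set W : ℝ → E := fun s => w (s : UnitAddCircle) with hWdef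
  have hWd : ∀ s : ℝ, HasDerivAt W ((2 * Real.pi) • J (u (s : UnitAddCircle))) s := by
    intro s
    have e : W = fun s => c + (2 * Real.pi) • J (loopPrim u s) := by
      ext s; simp only [hWdef, hw]; rfl
    have := (J.hasFDerivAt.comp_hasDerivAt s (hasDerivAt_loopPrim u s)).const_smul
      (2 * Real.pi) |>.const_add c
    rw [hu0, sub_zero] at this
    rw [e]
    exact this
  have hus : ∀ s : ℝ, rot J s (W s) + rot J s (u (s : UnitAddCircle))
      = (1 + a) • A (rot J s (W s)) := by
    intro s
    have e : u (s : UnitAddCircle) =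
        a • W s + (1 + a) • rotGrad J A h.cont w (s : UnitAddCircle) := by
      conv_lhs => rw [hu]
      rfl
    rw [e, rotGrad_apply, map_add, map_smul, map_smul, rot_rot_neg hJ]
    simp only [hWdef]
    module
  set x : ℝ → E := fun s => rot J s (W s) with hxdef
  have hκ : 0 < 2 * Real.pi * (1 + a) := by
    have := Real.pi_pos
    have := (abs_le.1 ha).1
    have : 0 < 1 + a := by linarith
    positivity
  have hxd : ∀ s, HasDerivAt x ((2 * Real.pi * (1 + a)) • J (A (x s))) s := by
    intro s
    refine (hasDerivAt_rot hJ (hWd s)).congr_deriv ?_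
    rw [map_smul, J_rot, ← smul_add, ← map_add, hus, map_smul, smul_smul]
  have hxc : Continuous x := continuous_iff_continuousAt.2 fun s => (hxd s).continuousAt
  have hconst : ∀ s, F (x s) = F (x 0) := by
    have hd : ∀ s, HasDerivAt (fun s => F (x s)) 0 s := by
      intro s
      refine ((h.hasFDerivAt (x s)).comp_hasDerivAt s (hxd s)).congr_deriv ?_
      rw [innerSL_apply_apply, inner_smul_right, inner_J_self hJ, mul_zero]
    intro s
    exact is_const_of_deriv_eq_zero (fun s => (hd s).differentiableAt) (fun s => (hd s).deriv) s 0
  have hF : F (x 0) = 1 / 2 := by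
    have hc := h.continuous
    have hcW : Continuous W := continuous_coe w
    rw [← hen, loopPair_apply, rotPot, ← intervalIntegral.integral_div,
      ← intervalIntegral.integral_add (intervalIntegrable_of_continuous (by fun_prop))
        (intervalIntegrable_of_continuous (by fun_prop))]
    have e : ∀ s : ℝ, ⟪w (s : UnitAddCircle), w (s : UnitAddCircle)⟫ / 2 +
        (F (rot J s (w (s : UnitAddCircle))) - ‖rot J s (w (s : UnitAddCircle))‖ ^ 2 / 2)
        = F (x 0) := fun s => by
      rw [real_inner_self_eq_norm_sq, norm_rot hJ, ← hconst s]
      simp only [hxdef, hWdef]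
      ring
    simp only [e]
    simp
  refine ⟨x, _, hκ, hxd, fun s => (hconst s).trans hF, fun s => ?_, ?_⟩
  · simp only [hxdef, hWdef, rot_add_one, AddCircle.coe_add_period]
  · by_contra! hcon
    have h1 : x = fun _ => x 0 := funext fun s => hcon s 0
    have h2 : HasDerivAt x 0 0 := by
      rw [h1]; exact hasDerivAt_const _ _
    have h3 := (hxd 0).unique h2
    rw [smul_eq_zero, or_iff_right hκ.ne', ← norm_eq_zero, norm_J hJ, norm_eq_zero] at h3
    have h4 := h.lip (x 0) (rot_mem_closedBall hJ (by simpa using hw2) 0) 0 (by simp)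
    rw [h3, h.grad_zero, sub_zero, sub_zero, zero_sub, sub_zero, norm_neg] at h4
    have h5 : x 0 = 0 := by
      rw [← norm_eq_zero]
      nlinarith [norm_nonneg (x 0), nearConst_le]
    rw [h5, h.zero] at hF
    norm_num at hF

end Hamiltonian

section Rescaling

variable {E : Type*} [NormedAddCommGroup E] [InnerProductSpace ℝ E] [CompleteSpace E]
  {f : E → ℝ} {lam : ℝ}

lemma hasFDerivAt_innerSL_gradient {x : E} (hf : DifferentiableAt ℝ f x) :
    HasFDerivAt f (innerSL ℝ (gradient f x)) x :=
  hf.hasGradientAt.hasFDerivAt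

lemma continuous_gradient (hf : ContDiff ℝ (⊤ : ℕ∞) f) : Continuous (gradient f) :=
  (InnerProductSpace.toDual ℝ E).symm.continuous.comp (hf.continuous_fderiv (by simp))

lemma exists_gradient_lipschitz (hf : ContDiff ℝ (⊤ : ℕ∞) f)
    (hHess : ∀ u v : E, iteratedFDeriv ℝ 2 f 0 ![u, v] = lam * ⟪u, v⟫) {δ : ℝ} (hδ : 0 < δ) :
    ∃ r > 0, ∀ x ∈ Metric.ball (0 : E) r, ∀ y ∈ Metric.ball (0 : E) r,
      ‖gradient f x - gradient f y - lam • (x - y)‖ ≤ δ * ‖x - y‖ := by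
  have h1 : ContDiff ℝ 1 (fderiv ℝ f) := hf.fderiv_right (by norm_cast)
  have h2 := h1.contDiffAt.hasStrictFDerivAt (x := (0 : E)) one_ne_zero
  have h3 : ∀ u, fderiv ℝ (fderiv ℝ f) 0 u = InnerProductSpace.toDual ℝ E (lam • u) := by
    intro u
    ext v
    have := hHess u v
    rw [iteratedFDeriv_two_apply] at this
    rw [InnerProductSpace.toDual_apply_apply, real_inner_smul_left]
    exact this
  obtain ⟨s, hs, hl⟩ := h2.approximates_deriv_on_nhds (c := ⟨δ, hδ.le⟩) (Or.inr hδ)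
  obtain ⟨r, hr, hrs⟩ := Metric.mem_nhds_iff.1 hs
  refine ⟨r, hr, fun x hx y hy => ?_⟩
  have h4 := hl x (hrs hx) y (hrs hy)
  rw [h3, ← (InnerProductSpace.toDual ℝ E).symm.norm_map, map_sub, map_sub,
    LinearIsometryEquiv.symm_apply_apply] at h4
  exact h4

lemma isNearQuadratic_rescale (hf : ContDiff ℝ (⊤ : ℕ∞) f) (hf0 : f 0 = 0)
    (hgrad : gradient f 0 = 0) (hlam : 0 < lam) {δ r ρ : ℝ}
    (hr : ∀ x ∈ Metric.ball (0 : E) r, ∀ y ∈ Metric.ball (0 : E) r,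
      ‖gradient f x - gradient f y - lam • (x - y)‖ ≤ δ * lam * ‖x - y‖)
    (hρ : 0 < ρ) (hρr : 2 * ρ < r) :
    IsNearQuadratic (fun y => (lam * ρ ^ 2)⁻¹ * f (ρ • y))
      (fun y => (lam * ρ)⁻¹ • gradient f (ρ • y)) δ where
  hasFDerivAt x := by
    have h1 := (hasFDerivAt_innerSL_gradient (hf.differentiable (by simp) (ρ • x))).comp x
      ((hasFDerivAt_id x).const_smul ρ)
    refine (h1.const_mul ((lam * ρ ^ 2)⁻¹)).congr_fderiv ?_
    ext v
    simp only [smul_apply, ContinuousLinearMap.comp_apply,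
      innerSL_apply_apply, ContinuousLinearMap.id_apply, inner_smul_left, inner_smul_right,
      smul_eq_mul, RCLike.conj_to_real]
    field_simp
  cont := ((continuous_gradient hf).comp (continuous_const_smul ρ)).const_smul _
  zero := by simp [hf0]
  grad_zero := by simp [hgrad]
  lip x hx y hy := by
    have hball : ∀ z ∈ Metric.closedBall (0 : E) 2, ρ • z ∈ Metric.ball (0 : E) r := by
      intro z hz
      rw [mem_closedBall_zero_iff] at hz
      rw [mem_ball_zero_iff, norm_smul, Real.norm_of_nonneg hρ.le]
      nlinarith
    have h1 := hr _ (hball x hx) _ (hball y hy)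
    have e : (lam * ρ)⁻¹ • gradient f (ρ • x) - x - ((lam * ρ)⁻¹ • gradient f (ρ • y) - y)
        = (lam * ρ)⁻¹ • (gradient f (ρ • x) - gradient f (ρ • y) - lam • (ρ • x - ρ • y)) := by
      have h2 : (lam * ρ)⁻¹ * (lam * ρ) = 1 := inv_mul_cancel₀ (by positivity)
      linear_combination (norm := module) h2 • (x - y)
    rw [← smul_sub, norm_smul ρ, Real.norm_of_nonneg hρ.le] at h1
    rw [e, norm_smul, norm_inv, Real.norm_of_nonneg (by positivity : 0 ≤ lam * ρ),
      inv_mul_le_iff₀ (by positivity), ← smul_sub]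
    linarith

/-- A smooth Hamiltonian whose Hessian at a critical point is a positive multiple of the
identity has a periodic orbit on every sufficiently small level. -/
theorem exists_periodic_orbit [FiniteDimensional ℝ E] [Nontrivial E] {J : E →L[ℝ] E}
    (hJ : IsComplexStructure J) (hf : ContDiff ℝ (⊤ : ℕ∞) f) (hf0 : f 0 = 0)
    (hgrad : gradient f 0 = 0) (hlam : 0 < lam)
    (hHess : ∀ u v : E, iteratedFDeriv ℝ 2 f 0 ![u, v] = lam * ⟪u, v⟫) :
    ∃ ε₀ > (0 : ℝ), ∀ ε ∈ Set.Ioo (0 : ℝ) ε₀, ∃ γ : ℝ → E,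
      (∀ t, HasDerivAt γ (J (gradient f (γ t))) t) ∧ (∀ t, f (γ t) = ε) ∧
        (∃ T > 0, ∀ t, γ (t + T) = γ t) ∧ ∃ t s, γ t ≠ γ s := by
  obtain ⟨r, hr0, hr⟩ := exists_gradient_lipschitz hf hHess (mul_pos nearConst_pos hlam)
  refine ⟨lam * r ^ 2 / 8, by positivity, fun ε ⟨hε, hεr⟩ => ?_⟩
  obtain ⟨ρ, hρ, hρε⟩ : ∃ ρ > 0, lam * ρ ^ 2 = 2 * ε :=
    ⟨√(2 * ε / lam), by positivity, by rw [Real.sq_sqrt (by positivity)]; field_simp⟩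
  have hρr : 2 * ρ < r := by
    refine lt_of_pow_lt_pow_left₀ 2 hr0.le ?_
    refine lt_of_mul_lt_mul_left ?_ hlam.le
    nlinarith
  obtain ⟨x, κ, hκ, hd, hF, hp, s, t, hst⟩ :=
    (isNearQuadratic_rescale hf hf0 hgrad hlam hr hρ hρr).exists_periodic hJ
  have hc : lam / κ ≠ 0 := by positivity
  refine ⟨fun t => ρ • x (lam / κ * t), fun t => ?_, fun t => ?_, ⟨κ / lam, by positivity,
    fun t => ?_⟩, (lam / κ)⁻¹ * s, (lam / κ)⁻¹ * t, ?_⟩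
  · have h1 : HasDerivAt (fun t : ℝ => lam / κ * t) (lam / κ) t := by
      simpa using (hasDerivAt_id t).const_mul (lam / κ)
    refine (((hd _).scomp t h1).const_smul ρ).congr_deriv ?_
    rw [map_smul, smul_smul, smul_smul, smul_smul]
    have e : ρ * (lam / κ * (κ * (lam * ρ)⁻¹)) = 1 := by field_simp
    simp only [mul_assoc] at e ⊢
    rw [e, one_smul]
  · have h1 := hF (lam / κ * t)
    rw [hρε, inv_mul_eq_iff_eq_mul₀ (by positivity)] at h1
    rw [h1]; ring
  · have e : lam / κ * (t + κ / lam) = lam / κ * t + 1 := by field_simp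
    simp only [e, hp]
  · simp only [mul_inv_cancel_left₀ hc]
    exact fun h => hst (smul_right_injective E hρ.ne' h)

end Rescaling

lemma isComplexStructure_I_smul (n : ℕ) : IsComplexStructure
    ((Complex.I • ContinuousLinearMap.id ℂ (EuclideanSpace ℂ (Fin n))).restrictScalars ℝ) where
  sq x := by
    change Complex.I • Complex.I • x = -x
    rw [smul_smul, Complex.I_mul_I, neg_one_smul]
  skew x y := by
    change ⟪Complex.I • x, y⟫ = -⟪x, Complex.I • y⟫
    simp only [PiLp.inner_apply, ← Finset.sum_neg_distrib]
    refine Finset.sum_congr rfl fun i _ => ?_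
    simp [Complex.inner]
    ring

/-- Near a non-degenerate minimum of a smooth Hamiltonian `f : ℝ^{2n} = ℂ^n → ℝ` whose
Hessian at the origin is `λ·Id` (all eigenvalues equal, `λ > 0`), every sufficiently
small level `{f = ε}` carries a periodic orbit of the Hamiltonian flow `γ' = i∇f(γ)`. -/
theorem periodic_orbit_equal_eigenvalues (n : ℕ) (hn : 1 ≤ n)
    (f : EuclideanSpace ℂ (Fin n) → ℝ) (hf : ContDiff ℝ (⊤ : ℕ∞) f)
    (hf0 : f 0 = 0) (hgrad : gradient f 0 = 0)
    (lam : ℝ) (hlam : 0 < lam)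
    (hHess : ∀ u v : EuclideanSpace ℂ (Fin n),
      iteratedFDeriv ℝ 2 f 0 ![u, v] = lam * ⟪u, v⟫) :
    ∃ ε₀ > (0 : ℝ), ∀ ε ∈ Set.Ioo (0 : ℝ) ε₀,
      ∃ γ : ℝ → EuclideanSpace ℂ (Fin n),
        (∀ t, HasDerivAt γ
          ((Complex.I • gradient f (γ t) : EuclideanSpace ℂ (Fin n))) t) ∧
        (∀ t, f (γ t) = ε) ∧
        (∃ T > 0, ∀ t, γ (t + T) = γ t) ∧
        (∃ t s, γ t ≠ γ s) := by
  have : Nontrivial (EuclideanSpace ℂ (Fin n)) := by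
    have : NeZero n := ⟨by omega⟩
    infer_instance
  exact exists_periodic_orbit (isComplexStructure_I_smul n) hf hf0 hgrad hlam hHess
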